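/- arXiv:1304.0571 — 2 statements merged into one kernel-verified Lean document; each statement's English description precedes it below -/
import Mathlib

section
/- Any Cantor rich set X ⊆ ℝ satisfies dim X = 1, where dim denotes Hausdorff dimension. -/
open MeasureTheory

/-- `(1/R)𝓘`: the collection obtained by dividing each compact interval of the
collection `𝓘` into `R` equal closed subintervals. -/
def splitR (R : ℕ) (C : Set (Set ℝ)) : Set (Set ℝ) :=
  {J | ∃ a b : ℝ, a ≤ b ∧ Set.Icc a b ∈ C ∧ ∃ k : ℕ, k < R ∧
    J = Set.Icc (a + k * ((b - a) / R)) (a + (k + 1) * ((b - a) / R))}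

/-- `(𝓘_q)_{q ≥ 0}` is an `R`-sequence in the compact interval `I₀`. -/
def IsRSeq (R : ℕ) (I₀ : Set ℝ) (C : ℕ → Set (Set ℝ)) : Prop :=
  C 0 = {I₀} ∧ ∀ q : ℕ, C (q + 1) ⊆ splitR R (C q)

/-- The limit (Cantor-type) set `𝒦(𝓘_q) = ⋂_q ⋃_{I ∈ 𝓘_q} I`. -/
def limitK (C : ℕ → Set (Set ℝ)) : Set ℝ := ⋂ q : ℕ, ⋃ J ∈ C q, J

/-- `𝓘̂_q = ((1/R)𝓘_{q-1}) \ 𝓘_q` (for `q ≥ 1`). -/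
def hatC (R : ℕ) (C : ℕ → Set (Set ℝ)) (q : ℕ) : Set (Set ℝ) :=
  splitR R (C (q - 1)) \ C q

/-- `d_q(𝓘_q)`: the minimum over all partitions `{𝓘̂_{q,p}}_{p=0}^{q-1}` of `𝓘̂_q`
of `∑_{p=0}^{q-1} (4/R)^{q-p} max_{I_p ∈ 𝓘_p} #(𝓘̂_{q,p} ⊓ I_p)` (computed in
`ℝ≥0∞`, using extended cardinality). -/
noncomputable def dq (R : ℕ) (C : ℕ → Set (Set ℝ)) (q : ℕ) : ENNReal :=
  ⨅ (P : ℕ → Set (Set ℝ)) (_ : hatC R C q = ⋃ p ∈ Finset.range q, P p),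
    ∑ p ∈ Finset.range q, (4 / (R : ENNReal)) ^ (q - p) *
      ⨆ Ip ∈ C p, (({J ∈ P p | J ⊆ Ip} : Set (Set ℝ)).encard : ENNReal)

/-- `d(𝓘_q) = sup_{q > 0} d_q(𝓘_q)`. -/
noncomputable def dC (R : ℕ) (C : ℕ → Set (Set ℝ)) : ENNReal :=
  ⨆ q : ℕ, ⨆ (_ : 0 < q), dq R C q

/-- `X` is `M`-Cantor rich in the compact interval `I₀`. -/
def MCantorRichIn (M : ℝ) (X : Set ℝ) (I₀ : Set ℝ) : Prop :=
  ∀ ε : ℝ, 0 < ε → ∀ R : ℕ, M ≤ (R : ℝ) → ∃ C : ℕ → Set (Set ℝ),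
    IsRSeq R I₀ C ∧ limitK C ⊆ X ∧ dC R C ≤ ENNReal.ofReal ε

/-- `X` is Cantor rich in `I₀`. -/
def CantorRichIn (X I₀ : Set ℝ) : Prop := ∃ M : ℝ, 1 < M ∧ MCantorRichIn M X I₀

open Classical in
/-- `GoodN A R m n q j`: there is an `m`-regular subtree of depth `n` below the node `j`
of level `q`, with all leaves in `A`. -/
def GoodN (A : ℕ → Set ℕ) (R m : ℕ) : ℕ → ℕ → ℕ → Prop
  | 0, q, j => j ∈ A q
  | n + 1, q, j => m ≤ ((Finset.range R).filter
      (fun k => GoodN A R m n (q + 1) (R * j + k))).card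

open Classical in
/-- The nodes of the bad subtree that lie in `A`. -/
noncomputable def badF (A : ℕ → Set ℕ) (R m n : ℕ) : ℕ → Finset ℕ
  | 0 => {0}
  | i + 1 => (Finset.range (R ^ (i + 1))).filter
      (fun x => x / R ∈ badF A R m n i ∧ ¬ GoodN A R m (n - (i + 1)) (i + 1) x ∧ x ∈ A (i + 1))

/-- The combinatorial hypothesis extracted from `d ≤ 1`. -/
def CombHyp (A : ℕ → Set ℕ) (R : ℕ) : Prop :=
  ∀ q : ℕ, ∃ h : ℕ → ℝ, ∃ P : ℕ → Set ℕ, (∀ p, 0 ≤ h p) ∧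
    ∑ p ∈ Finset.range (q + 1), (4 / (R : ℝ)) ^ (q + 1 - p) * h p ≤ 1 ∧
    (∀ x, x / R ∈ A q → x ∉ A (q + 1) → ∃ p < q + 1, x ∈ P p) ∧
    ∀ p < q + 1, ∀ j ∈ A p, ∀ F : Finset ℕ,
      (∀ x ∈ F, x ∈ P p ∧ x / R ^ (q + 1 - p) = j) → (F.card : ℝ) ≤ h p

theorem badF_lt (A : ℕ → Set ℕ) (R m n i : ℕ) : ∀ x ∈ badF A R m n i, x < R ^ i := by
  intro x hx
  cases i with
  | zero => simp [badF] at hx; simp [hx]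
  | succ i => simp only [badF, Finset.mem_filter, Finset.mem_range] at hx; exact hx.1

theorem badF_A (A : ℕ → Set ℕ) (R m n i : ℕ) (h0 : 0 ∈ A 0) : ∀ x ∈ badF A R m n i, x ∈ A i := by
  intro x hx
  cases i with
  | zero => simp [badF] at hx; simpa [hx] using h0
  | succ i => simp only [badF, Finset.mem_filter] at hx; exact hx.2.2.2

theorem badF_bad (A : ℕ → Set ℕ) (R m n i : ℕ) (hn : ¬ GoodN A R m n 0 0) :
    ∀ x ∈ badF A R m n i, ¬ GoodN A R m (n - i) i x := by
  intro x hx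
  cases i with
  | zero => simp [badF] at hx; simpa [hx] using hn
  | succ i => simp only [badF, Finset.mem_filter] at hx; exact hx.2.2.1

theorem badF_anc (A : ℕ → Set ℕ) (R m n p i : ℕ) :
    ∀ x ∈ badF A R m n (p + i), x / R ^ i ∈ badF A R m n p := by
  induction i with
  | zero => intro x hx; simpa using hx
  | succ i ih =>
    intro x hx
    have hx' : x / R ∈ badF A R m n (p + i) := by
      rw [← add_assoc] at hx
      simp only [badF, Finset.mem_filter] at hx; exact hx.2.1
    have := ih _ hx'
    rwa [Nat.div_div_eq_div_mul, ← pow_succ'] at this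

open Classical in
theorem badF_step (A : ℕ → Set ℕ) (R m n q : ℕ) (hR : R = 2 * m) (hm : 1 ≤ m)
    (h0 : 0 ∈ A 0) (hyp : CombHyp A R)
    (hn : ¬ GoodN A R m n 0 0) (hq : q < n)
    (ih : ∀ p < q, ((badF A R m n p).card : ℝ) ≤ 4 / R * (badF A R m n (p + 1)).card) :
    ((badF A R m n q).card : ℝ) ≤ 4 / R * (badF A R m n (q + 1)).card := by
  have hRpos : 0 < R := by omega
  have hRr : (0 : ℝ) < R := by exact_mod_cast hRpos
  obtain ⟨h, P, hpos, hsum, hcov, hcnt⟩ := hyp q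
  set f : ℕ → ℝ := fun p => ((badF A R m n p).card : ℝ) with hf
  set E : Finset ℕ := (Finset.range (R ^ (q + 1))).filter
      (fun x => x / R ∈ badF A R m n q ∧ ¬ GoodN A R m (n - (q + 1)) (q + 1) x) with hE
  -- lower bound on E
  have hlow : (R / 2 : ℝ) * f q ≤ E.card := by
    have h1 : E.card = ∑ j ∈ badF A R m n q, (E.filter (fun x => x / R = j)).card :=
      Finset.card_eq_sum_card_fiberwise (fun x hx => by
        have hx' : x ∈ E := hx
        rw [hE, Finset.mem_filter] at hx'; exact hx'.2.1)
    have h2 : ∀ j ∈ badF A R m n q, m ≤ (E.filter (fun x => x / R = j)).card := by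
      intro j hj
      have hbad := badF_bad A R m n q hn j hj
      obtain ⟨d, hd⟩ : ∃ d, n - q = d + 1 := ⟨n - q - 1, by omega⟩
      have hd' : n - (q + 1) = d := by omega
      rw [hd] at hbad
      simp only [GoodN, not_le] at hbad
      have h3 := Finset.card_filter_add_card_filter_not (s := Finset.range R)
        (fun k => GoodN A R m d (q + 1) (R * j + k))
      rw [Finset.card_range] at h3
      have h4 : m ≤ ((Finset.range R).filter
        (fun k => ¬ GoodN A R m d (q + 1) (R * j + k))).card := by omega
      refine h4.trans ?_
      refine Finset.card_le_card_of_injOn (fun k => R * j + k) ?_ ?_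
      · intro k hk
        have hk' := Finset.mem_filter.1 hk
        have hkR := Finset.mem_range.1 hk'.1
        have hdiv : (R * j + k) / R = j := by
          rw [Nat.mul_add_div hRpos, Nat.div_eq_of_lt hkR, add_zero]
        have hjl := badF_lt A R m n q j hj
        refine Finset.mem_filter.2 ⟨Finset.mem_filter.2 ⟨Finset.mem_range.2 ?_, ?_, ?_⟩, hdiv⟩
        · calc R * j + k < R * j + R := by omega
            _ = R * (j + 1) := by ring
            _ ≤ R * R ^ q := Nat.mul_le_mul_left _ hjl
            _ = R ^ (q + 1) := by ring
        · rw [hdiv]; exact hj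
        · rw [hd']; exact hk'.2
      · intro x _ y _ hxy
        simpa using hxy
    have h3 : (badF A R m n q).card * m ≤ E.card := by
      rw [h1, ← smul_eq_mul]
      exact Finset.card_nsmul_le_sum _ _ _ h2
    have h4 : f q * m ≤ E.card := by
      simp only [hf]; exact_mod_cast h3
    have : (R : ℝ) = 2 * m := by exact_mod_cast hR
    rw [this]; linarith
  have hup : (E.card : ℝ) ≤ f (q + 1) + ∑ p ∈ Finset.range (q + 1), f p * h p := by
    have h1 := Finset.card_filter_add_card_filter_not (s := E) (fun x => x ∈ A (q + 1))
    have h2 : E.filter (fun x => x ∈ A (q + 1)) = badF A R m n (q + 1) := by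
      ext x
      simp only [hE, badF, Finset.mem_filter, and_assoc]
    rw [h2] at h1
    have h3 : E.filter (fun x => ¬ x ∈ A (q + 1)) ⊆
        (Finset.range (q + 1)).biUnion (fun p => E.filter (fun x => x ∈ P p)) := by
      intro x hx
      have hx' := Finset.mem_filter.1 hx
      have hx2 := (Finset.mem_filter.1 hx'.1).2.1
      obtain ⟨p, hp, hxp⟩ := hcov x (badF_A A R m n q h0 _ hx2) hx'.2
      exact Finset.mem_biUnion.2 ⟨p, Finset.mem_range.2 hp, Finset.mem_filter.2 ⟨hx'.1, hxp⟩⟩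
    have h4 := (Finset.card_le_card h3).trans Finset.card_biUnion_le
    have h5 : ∀ p ∈ Finset.range (q + 1), ((E.filter (fun x => x ∈ P p)).card : ℝ) ≤ f p * h p := by
      intro p hp
      have hp' := Finset.mem_range.1 hp
      have h6 : (E.filter (fun x => x ∈ P p)).card = ∑ j ∈ badF A R m n p,
          ((E.filter (fun x => x ∈ P p)).filter (fun x => x / R ^ (q + 1 - p) = j)).card :=
        Finset.card_eq_sum_card_fiberwise (fun x hx => by
          have hx' : x ∈ E.filter (fun x => x ∈ P p) := hx
          have hx2 := (Finset.mem_filter.1 (Finset.mem_filter.1 hx').1).2.1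
          obtain ⟨i, rfl⟩ : ∃ i, q = p + i := ⟨q - p, by omega⟩
          have := badF_anc A R m n p i _ hx2
          rw [Nat.div_div_eq_div_mul, ← pow_succ'] at this
          have e : p + i + 1 - p = i + 1 := by omega
          simpa [e] using this)
      rw [h6, Nat.cast_sum]
      have := Finset.sum_le_card_nsmul (badF A R m n p) (fun j => (((E.filter (fun x => x ∈ P p)).filter
        (fun x => x / R ^ (q + 1 - p) = j)).card : ℝ)) (h p) (fun j hj =>
          hcnt p hp' j (badF_A A R m n p h0 j hj) _ (fun x hx => by
            have := Finset.mem_filter.1 hx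
            exact ⟨(Finset.mem_filter.1 this.1).2, this.2⟩))
      simpa [nsmul_eq_mul] using this
    have h7 : ((E.filter (fun x => ¬ x ∈ A (q + 1))).card : ℝ) ≤
        ∑ p ∈ Finset.range (q + 1), f p * h p := by
      refine le_trans ?_ (Finset.sum_le_sum h5)
      exact_mod_cast h4
    have h8 : (f (q + 1) : ℝ) + ((E.filter (fun x => ¬ x ∈ A (q + 1))).card : ℝ) = E.card := by
      simp only [hf]; exact_mod_cast h1
    linarith
  have hanc : ∀ i p, p + i = q → f p ≤ (4 / (R : ℝ)) ^ i * f q := by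
    intro i
    induction i with
    | zero => intro p hp; simp at hp; simp [hp]
    | succ i ihi =>
      intro p hp
      have h1 := ih p (by omega)
      have h2 := ihi (p + 1) (by omega)
      calc f p ≤ 4 / R * f (p + 1) := h1
        _ ≤ 4 / R * ((4 / (R : ℝ)) ^ i * f q) := by gcongr
        _ = _ := by ring
  have hS : ∑ p ∈ Finset.range (q + 1), f p * h p ≤ f q * (R / 4) := by
    calc ∑ p ∈ Finset.range (q + 1), f p * h p
        ≤ ∑ p ∈ Finset.range (q + 1), f q * (R / 4) * ((4 / (R : ℝ)) ^ (q + 1 - p) * h p) := by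
          refine Finset.sum_le_sum (fun p hp => ?_)
          have hp' := Finset.mem_range.1 hp
          obtain ⟨i, rfl⟩ : ∃ i, q = p + i := ⟨q - p, by omega⟩
          have e : p + i + 1 - p = i + 1 := by omega
          have h1 := hanc i p rfl
          calc f p * h p ≤ ((4 / (R : ℝ)) ^ i * f (p + i)) * h p :=
                mul_le_mul_of_nonneg_right h1 (hpos p)
            _ = _ := by rw [e, pow_succ]; field_simp
      _ = f q * (R / 4) * ∑ p ∈ Finset.range (q + 1), ((4 / (R : ℝ)) ^ (q + 1 - p) * h p) := by
          rw [Finset.mul_sum]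
      _ ≤ f q * (R / 4) * 1 := by
          apply mul_le_mul_of_nonneg_left hsum
          have : (0 : ℝ) ≤ f q := Nat.cast_nonneg _
          positivity
      _ = _ := by ring
  change f q ≤ 4 / R * f (q + 1)
  rw [div_mul_eq_mul_div, le_div_iff₀ hRr]
  nlinarith

theorem goodN_root (A : ℕ → Set ℕ) (R m : ℕ) (hR : R = 2 * m) (hm : 1 ≤ m)
    (h0 : 0 ∈ A 0) (hyp : CombHyp A R) (n : ℕ) : GoodN A R m n 0 0 := by
  by_contra hn
  have hRpos : 0 < R := by omega
  have hRr : (0 : ℝ) < R := by exact_mod_cast hRpos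
  have h1 : ∀ q < n, ((badF A R m n q).card : ℝ) ≤ 4 / R * (badF A R m n (q + 1)).card := by
    intro q
    induction q using Nat.strong_induction_on with
    | _ q ih =>
      intro hq
      exact badF_step A R m n q hR hm h0 hyp hn hq (fun p hp => ih p hp (by omega))
  have h2 : ∀ q ≤ n, 0 < (badF A R m n q).card := by
    intro q
    induction q with
    | zero => intro _; simp [badF]
    | succ q ih =>
      intro hq
      have h3 : (0 : ℝ) < (badF A R m n q).card := by exact_mod_cast ih (by omega)
      have h4 := h1 q (by omega)
      by_contra h5
      have h6 : (badF A R m n (q + 1)).card = 0 := by omega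
      rw [h6] at h4
      simp at h4
      simp [h4] at h3
  obtain ⟨x, hx⟩ := Finset.card_pos.1 (h2 n le_rfl)
  have h3 := badF_bad A R m n n hn x hx
  rw [Nat.sub_self] at h3
  exact h3 (badF_A A R m n n h0 x hx)

theorem goodN_A (A : ℕ → Set ℕ) (R m : ℕ) (hm : 1 ≤ m)
    (hpar : ∀ q x, x ∈ A (q + 1) → x / R ∈ A q) (n q j : ℕ) (h : GoodN A R m n q j) :
    j ∈ A q := by
  classical
  induction n generalizing q j with
  | zero => exact h
  | succ n ih =>
    simp only [GoodN] at h
    obtain ⟨k, hk⟩ := Finset.card_pos.1 (lt_of_lt_of_le hm h)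
    have hk := Finset.mem_filter.1 hk
    have hkR := Finset.mem_range.1 hk.1
    have h1 := hpar q _ (ih _ _ hk.2)
    rwa [Nat.mul_add_div (by omega), Nat.div_eq_of_lt hkR, add_zero] at h1

theorem goodN_anti (A : ℕ → Set ℕ) (R m : ℕ) (hm : 1 ≤ m)
    (hpar : ∀ q x, x ∈ A (q + 1) → x / R ∈ A q) (n q j : ℕ) (h : GoodN A R m (n + 1) q j) :
    GoodN A R m n q j := by
  classical
  induction n generalizing q j with
  | zero => exact goodN_A A R m hm hpar 1 q j h
  | succ n ih =>
    rw [GoodN] at h ⊢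
    refine h.trans (Finset.card_le_card ?_)
    intro k hk
    have hk := Finset.mem_filter.1 hk
    exact Finset.mem_filter.2 ⟨hk.1, ih _ _ hk.2⟩

open Classical in
theorem exists_regular (A : ℕ → Set ℕ) (R m : ℕ) (hR : R = 2 * m) (hm : 1 ≤ m)
    (h0 : 0 ∈ A 0) (hpar : ∀ q x, x ∈ A (q + 1) → x / R ∈ A q) (hyp : CombHyp A R) :
    ∃ G : ℕ → Set ℕ, 0 ∈ G 0 ∧ (∀ q, G q ⊆ A q) ∧
      ∀ q, ∀ j ∈ G q, m ≤ ((Finset.range R).filter (fun k => R * j + k ∈ G (q + 1))).card := by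
  refine ⟨fun q => {j | ∀ n, GoodN A R m n q j}, fun n => goodN_root A R m hR hm h0 hyp n,
    fun q j hj => hj 0, fun q j hj => ?_⟩
  have hanti : ∀ q j, Antitone (fun n => GoodN A R m n q j) := fun q j =>
    antitone_nat_of_succ_le (fun n h => goodN_anti A R m hm hpar n q j h)
  -- choose a depth at which all the non-good children fail
  have hN : ∃ N, ∀ k < R, GoodN A R m N (q + 1) (R * j + k) →
      ∀ n, GoodN A R m n (q + 1) (R * j + k) := by
    have : ∀ k, ∃ N, GoodN A R m N (q + 1) (R * j + k) →
      ∀ n, GoodN A R m n (q + 1) (R * j + k) := by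
      intro k
      by_cases hk : ∀ n, GoodN A R m n (q + 1) (R * j + k)
      · exact ⟨0, fun _ => hk⟩
      · push Not at hk
        obtain ⟨N, hN⟩ := hk
        exact ⟨N, fun h => absurd h hN⟩
    choose N hN using this
    refine ⟨(Finset.range R).sup N, fun k hk h => hN k ?_⟩
    exact hanti _ _ (Finset.le_sup (f := N) (Finset.mem_range.2 hk)) h
  obtain ⟨N, hN⟩ := hN
  have h1 := hj (N + 1)
  rw [GoodN] at h1
  refine h1.trans (Finset.card_le_card ?_)
  intro k hk
  have hk := Finset.mem_filter.1 hk
  exact Finset.mem_filter.2 ⟨hk.1, hN k (Finset.mem_range.1 hk.1) hk.2⟩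

/-- The `j`-th interval of level `q` in the `R`-adic subdivision of `[a, a + L]`. -/
def iv (a L : ℝ) (R q j : ℕ) : Set ℝ :=
  Set.Icc (a + j * (L / R ^ q)) (a + (j + 1) * (L / R ^ q))

theorem Icc_ends {a b c d : ℝ} (h : a ≤ b) (h' : c ≤ d) (e : Set.Icc a b = Set.Icc c d) :
    a = c ∧ b = d := by
  constructor
  · rw [← csInf_Icc h, e, csInf_Icc h']
  · rw [← csSup_Icc h, e, csSup_Icc h']

theorem iv_le {a L : ℝ} (hL : 0 < L) (R q j : ℕ) :
    a + j * (L / (R : ℝ) ^ q) ≤ a + (j + 1) * (L / (R : ℝ) ^ q) := by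
  have : 0 ≤ L / (R : ℝ) ^ q := by positivity
  nlinarith

theorem iv_inj {a L : ℝ} (hL : 0 < L) {R : ℕ} (hR : 0 < R) {q j k : ℕ}
    (e : iv a L R q j = iv a L R q k) : j = k := by
  have h1 := (Icc_ends (iv_le hL R q j) (iv_le hL R q k) e).1
  have h2 : 0 < L / (R : ℝ) ^ q := by positivity
  have h3 : (j : ℝ) = k := by
    have : (j : ℝ) * (L / (R : ℝ) ^ q) = k * (L / (R : ℝ) ^ q) := by linarith
    exact mul_right_cancel₀ h2.ne' this
  exact_mod_cast h3

theorem iv_child {a L : ℝ} {R : ℕ} (hR : 0 < R) (q j k : ℕ) :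
    Set.Icc (a + j * (L / (R : ℝ) ^ q) + k * (((a + (j + 1) * (L / (R : ℝ) ^ q)) -
        (a + j * (L / (R : ℝ) ^ q))) / R))
      (a + j * (L / (R : ℝ) ^ q) + (k + 1) * (((a + (j + 1) * (L / (R : ℝ) ^ q)) -
        (a + j * (L / (R : ℝ) ^ q))) / R)) = iv a L R (q + 1) (R * j + k) := by
  have hR' : (0 : ℝ) < R := by exact_mod_cast hR
  unfold iv
  congr 1
  · push_cast; field_simp; ring
  · push_cast; field_simp; ring

theorem iv_sub {a L : ℝ} (hL : 0 < L) {R : ℕ} (hR : 0 < R) (q x : ℕ) :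
    iv a L R (q + 1) x ⊆ iv a L R q (x / R) := by
  have hR' : (0 : ℝ) < R := by exact_mod_cast hR
  have hd : 0 < L / (R : ℝ) ^ (q + 1) := by positivity
  have e : L / (R : ℝ) ^ q = R * (L / (R : ℝ) ^ (q + 1)) := by field_simp; ring
  unfold iv
  have h1 : ((R * (x / R) : ℕ) : ℝ) ≤ x := by exact_mod_cast Nat.mul_div_le x R
  have h2 : ((x + 1 : ℕ) : ℝ) ≤ ((R * (x / R + 1) : ℕ) : ℝ) := by
    exact_mod_cast Nat.lt_mul_div_succ x hR
  push_cast at h1 h2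
  apply Set.Icc_subset_Icc
  · rw [e]; nlinarith
  · rw [e]; nlinarith

theorem iv_sub_pow {a L : ℝ} (hL : 0 < L) {R : ℕ} (hR : 0 < R) (p i x : ℕ) :
    iv a L R (p + i) x ⊆ iv a L R p (x / R ^ i) := by
  induction i generalizing x with
  | zero => simp
  | succ i ih =>
    rw [pow_succ', ← Nat.div_div_eq_div_mul]
    exact (iv_sub hL hR (p + i) x).trans (ih _)

theorem rseq_range {a b : ℝ} (hab : a < b) {R : ℕ} (hR : 0 < R) {C : ℕ → Set (Set ℝ)}
    (hC : IsRSeq R (Set.Icc a b) C) (q : ℕ) : ∀ J ∈ C q, ∃ j, J = iv a (b - a) R q j := by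
  induction q with
  | zero =>
    intro J hJ
    rw [hC.1] at hJ
    refine ⟨0, ?_⟩
    rw [Set.mem_singleton_iff.1 hJ]
    simp [iv]
  | succ q ih =>
    intro J hJ
    obtain ⟨c, d, hcd, hm, k, hk, rfl⟩ := hC.2 q hJ
    obtain ⟨j, hj⟩ := ih _ hm
    obtain ⟨rfl, rfl⟩ := Icc_ends hcd (iv_le (sub_pos.2 hab) R q j) hj
    exact ⟨R * j + k, iv_child hR q j k⟩

theorem split_iff {a b : ℝ} (hab : a < b) {R : ℕ} (hR : 0 < R) {C : ℕ → Set (Set ℝ)}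
    (hC : IsRSeq R (Set.Icc a b) C) (q x : ℕ) :
    iv a (b - a) R (q + 1) x ∈ splitR R (C q) ↔ iv a (b - a) R q (x / R) ∈ C q := by
  have hL := sub_pos.2 hab
  constructor
  · rintro ⟨c, d, hcd, hm, k, hk, e⟩
    obtain ⟨j, hj⟩ := rseq_range hab hR hC q _ hm
    obtain ⟨rfl, rfl⟩ := Icc_ends hcd (iv_le hL R q j) hj
    rw [iv_child hR q j k] at e
    have := iv_inj hL hR e
    rw [this, Nat.mul_add_div hR, Nat.div_eq_of_lt hk, add_zero, ← hj]
    exact hm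
  · intro h
    refine ⟨_, _, iv_le hL R q (x / R), h, x % R, Nat.mod_lt _ hR, ?_⟩
    rw [iv_child hR q, Nat.div_add_mod]

theorem combHyp_of {a b : ℝ} (hab : a < b) {R : ℕ} (hR : 0 < R) {C : ℕ → Set (Set ℝ)}
    (hC : IsRSeq R (Set.Icc a b) C) (hd : dC R C ≤ ENNReal.ofReal (1 / 2)) :
    CombHyp (fun q => {j | iv a (b - a) R q j ∈ C q}) R := by
  classical
  have hL := sub_pos.2 hab
  intro q
  have h1 : dq R C (q + 1) < 1 := by
    have h2 : dq R C (q + 1) ≤ dC R C := by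
      unfold dC
      exact le_iSup₂_of_le (q + 1) (Nat.succ_pos q) le_rfl
    refine (h2.trans hd).trans_lt ?_
    rw [ENNReal.ofReal_lt_one]; norm_num
  unfold dq at h1
  simp only [iInf_lt_iff] at h1
  obtain ⟨P, hP, hs⟩ := h1
  set H : ℕ → ENNReal := fun p =>
    ⨆ Ip ∈ C p, (({J ∈ P p | J ⊆ Ip} : Set (Set ℝ)).encard : ENNReal) with hH
  have hterm : ∀ p ∈ Finset.range (q + 1), (4 / (R : ENNReal)) ^ (q + 1 - p) * H p < 1 := by
    intro p hp
    refine lt_of_le_of_lt ?_ hs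
    exact Finset.single_le_sum (f := fun p => (4 / (R : ENNReal)) ^ (q + 1 - p) * H p)
      (fun _ _ => zero_le) hp
  have hfin : ∀ p < q + 1, H p ≠ ⊤ := by
    intro p hp htop
    have := hterm p (Finset.mem_range.2 hp)
    rw [htop, ENNReal.mul_top] at this
    · exact absurd this (by simp)
    · apply pow_ne_zero
      exact (ENNReal.div_pos (by norm_num) (ENNReal.natCast_ne_top R)).ne'
  refine ⟨fun p => (H p).toReal, fun p => {x | iv a (b - a) R (q + 1) x ∈ P p},
    fun p => ENNReal.toReal_nonneg, ?_, ?_, ?_⟩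
  · have h2 := ENNReal.toReal_mono ENNReal.one_ne_top hs.le
    rw [ENNReal.toReal_sum (fun p hp => ((hterm p hp).trans ENNReal.one_lt_top).ne)] at h2
    simpa [ENNReal.toReal_mul, ENNReal.toReal_pow, ENNReal.toReal_div] using h2
  · intro x hx hx'
    have h2 : iv a (b - a) R (q + 1) x ∈ hatC R C (q + 1) :=
      ⟨(split_iff hab hR hC q x).2 hx, hx'⟩
    rw [hP] at h2
    simpa using h2
  · intro p hp j hj F hF
    have h2 : (F.image (iv a (b - a) R (q + 1)) : Set (Set ℝ)) ⊆
        {J ∈ P p | J ⊆ iv a (b - a) R p j} := by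
      intro J hJ
      simp only [Finset.coe_image, Set.mem_image, Finset.mem_coe] at hJ
      obtain ⟨x, hx, rfl⟩ := hJ
      refine ⟨(hF x hx).1, ?_⟩
      rw [← (hF x hx).2]
      have := iv_sub_pow (a := a) hL hR p (q + 1 - p) x
      rwa [show p + (q + 1 - p) = q + 1 by omega] at this
    have h3 := Set.encard_le_encard h2
    rw [Set.encard_coe_eq_coe_finsetCard, Finset.card_image_of_injective _
      (fun x y h => iv_inj hL hR h)] at h3
    have h4 : ((F.card : ENat) : ENNReal) ≤ H p :=
      le_trans (ENat.toENNReal_le.2 h3) (le_iSup₂_of_le (iv a (b - a) R p j) hj le_rfl)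
    have h5 := ENNReal.toReal_mono (hfin p hp) h4
    simpa using h5


theorem exists_enum {R m : ℕ} (S : Finset ℕ) (h : m ≤ S.card) :
    ∃ c : ℕ → ℕ, (∀ r < m, c r ∈ S) ∧ ∀ r < m, ∀ r' < m, c r = c r' → r = r' := by
  obtain ⟨T, hT, hc⟩ := Finset.exists_subset_card_eq h
  refine ⟨fun r => if h : r < m then T.orderEmbOfFin hc ⟨r, h⟩ else 0, ?_, ?_⟩
  · intro r hr
    simp only [hr, dif_pos]
    exact hT (Finset.orderEmbOfFin_mem T hc _)
  · intro r hr r' hr' e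
    simp only [hr, hr', dif_pos] at e
    have := (T.orderEmbOfFin hc).injective e
    simpa using this

/-- Enumeration of the level `q` nodes of a regular subtree. -/
def phi (R m : ℕ) (c : ℕ → ℕ → ℕ → ℕ) : ℕ → ℕ → ℕ
  | 0, _ => 0
  | q + 1, i => R * phi R m c q (i / m) + c q (phi R m c q (i / m)) (i % m)

theorem exists_phi {R m : ℕ} (hR : 0 < R) (hm : 0 < m) (G : ℕ → Set ℕ) (h0 : 0 ∈ G 0)
    (hG : ∀ q, ∀ j ∈ G q, ∃ S : Finset ℕ, (∀ k ∈ S, k < R ∧ R * j + k ∈ G (q + 1)) ∧ m ≤ S.card) :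
    ∃ φ : ℕ → ℕ → ℕ, (∀ q i, φ q i ∈ G q) ∧ (∀ q i, φ (q + 1) i / R = φ q (i / m)) ∧
      ∀ q, ∀ i < m ^ q, ∀ i' < m ^ q, φ q i = φ q i' → i = i' := by
  have hc : ∀ q j, ∃ c : ℕ → ℕ, j ∈ G q → (∀ r < m, c r < R ∧ R * j + c r ∈ G (q + 1)) ∧
      ∀ r < m, ∀ r' < m, c r = c r' → r = r' := by
    intro q j
    by_cases hj : j ∈ G q
    · obtain ⟨S, hS, hcard⟩ := hG q j hj
      obtain ⟨c, h1, h2⟩ := exists_enum (R := R) S hcard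
      exact ⟨c, fun _ => ⟨fun r hr => hS _ (h1 r hr), h2⟩⟩
    · exact ⟨fun _ => 0, fun h => absurd h hj⟩
  choose c hc using hc
  have hmem : ∀ q i, phi R m c q i ∈ G q := by
    intro q
    induction q with
    | zero => intro i; exact h0
    | succ q ih => intro i; exact ((hc q _ (ih (i / m))).1 _ (Nat.mod_lt _ hm)).2
  have hdiv : ∀ q i, phi R m c (q + 1) i / R = phi R m c q (i / m) := by
    intro q i
    rw [phi, Nat.mul_add_div hR,
      Nat.div_eq_of_lt ((hc q _ (hmem q (i / m))).1 _ (Nat.mod_lt _ hm)).1, add_zero]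
  refine ⟨phi R m c, hmem, hdiv, ?_⟩
  intro q
  induction q with
  | zero => intro i hi i' hi' _; simp at hi hi'; omega
  | succ q ih =>
    intro i hi i' hi' e
    have h1 : phi R m c q (i / m) = phi R m c q (i' / m) := by rw [← hdiv, ← hdiv, e]
    have h2 := ih (i / m) (Nat.div_lt_of_lt_mul (by rwa [pow_succ'] at hi))
      (i' / m) (Nat.div_lt_of_lt_mul (by rwa [pow_succ'] at hi')) h1
    rw [phi, phi, ← h2] at e
    have h3 := (hc q _ (hmem q (i / m))).2 _ (Nat.mod_lt i hm) _ (Nat.mod_lt i' hm) (by omega)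
    rw [← Nat.div_add_mod i m, ← Nat.div_add_mod i' m, h2, h3]

theorem exists_g {a L : ℝ} (hL : 0 < L) {R m : ℕ} (hR : 0 < R) (hm : 0 < m) (φ : ℕ → ℕ → ℕ)
    (hφ : ∀ q i, φ (q + 1) i / R = φ q (i / m)) :
    ∃ g : ℝ → ℝ, Measurable g ∧ ∀ q u, g u ∈ iv a L R q (φ q ⌊(m : ℝ) ^ q * u⌋₊) := by
  refine ⟨fun u => ⨆ q : ℕ, (a + (φ q ⌊(m : ℝ) ^ q * u⌋₊ : ℕ) * (L / (R : ℝ) ^ q)), ?_, ?_⟩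
  · refine Measurable.iSup (fun q => ?_)
    have h1 : Measurable (fun u : ℝ => ⌊(m : ℝ) ^ q * u⌋₊) :=
      Nat.measurable_floor.comp (measurable_const_mul _)
    have h2 : Measurable (fun n : ℕ => a + (φ q n : ℝ) * (L / (R : ℝ) ^ q)) :=
      measurable_from_top
    exact h2.comp h1
  · intro q u
    have hm' : (m : ℝ) ≠ 0 := by exact_mod_cast hm.ne'
    have hanti : Antitone (fun q => Set.Icc
        (a + (φ q ⌊(m : ℝ) ^ q * u⌋₊ : ℕ) * (L / (R : ℝ) ^ q))
        (a + ((φ q ⌊(m : ℝ) ^ q * u⌋₊ : ℕ) + 1) * (L / (R : ℝ) ^ q))) := by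
      refine antitone_nat_of_succ_le (fun q => ?_)
      have h1 := iv_sub (a := a) hL hR q (φ (q + 1) ⌊(m : ℝ) ^ (q + 1) * u⌋₊)
      rw [hφ, ← Nat.floor_div_natCast] at h1
      have e : (m : ℝ) ^ (q + 1) * u / m = (m : ℝ) ^ q * u := by field_simp; ring
      rw [e] at h1
      exact h1
    have := ciSup_mem_iInter_Icc_of_antitone_Icc hanti (fun q => iv_le hL R q _)
    exact Set.mem_iInter.1 this q

theorem vol_est {a L : ℝ} (hL : 0 < L) {R m : ℕ} (hR : 0 < R) (hm : 0 < m) (φ : ℕ → ℕ → ℕ)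
    (hinj : ∀ q, ∀ i < m ^ q, ∀ i' < m ^ q, φ q i = φ q i' → i = i')
    (g : ℝ → ℝ) (hg : ∀ q u, g u ∈ iv a L R q (φ q ⌊(m : ℝ) ^ q * u⌋₊)) (q : ℕ) (x : ℝ) :
    volume (g ⁻¹' (Set.Icc (x - L / (R : ℝ) ^ q) (x + L / (R : ℝ) ^ q)) ∩ Set.Ico 0 1) ≤
      ENNReal.ofReal (4 / (m : ℝ) ^ q) := by
  classical
  have hR' : (0 : ℝ) < R := by exact_mod_cast hR
  have hm' : (0 : ℝ) < m := by exact_mod_cast hm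
  have hmq : (0 : ℝ) < (m : ℝ) ^ q := by positivity
  set δ := L / (R : ℝ) ^ q with hδ
  have hδp : 0 < δ := by positivity
  set n0 := ⌈(x - a) / δ - 2⌉₊ with hn0
  set I := (Finset.range (m ^ q)).filter (fun i => φ q i ∈ Finset.Ico n0 (n0 + 4)) with hI
  have hcard : I.card ≤ 4 := by
    have : I.card ≤ (Finset.Ico n0 (n0 + 4)).card := by
      refine Finset.card_le_card_of_injOn (φ q) (fun i hi => (Finset.mem_filter.1 hi).2) ?_
      intro i hi i' hi' e
      exact hinj q i (Finset.mem_range.1 (Finset.mem_filter.1 hi).1) i'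
        (Finset.mem_range.1 (Finset.mem_filter.1 hi').1) e
    simpa using this
  have hsub : g ⁻¹' (Set.Icc (x - δ) (x + δ)) ∩ Set.Ico 0 1 ⊆
      ⋃ i ∈ I, Set.Ico ((i : ℝ) / (m : ℝ) ^ q) ((i + 1) / (m : ℝ) ^ q) := by
    rintro u ⟨hu, hu0, hu1⟩
    have hgu := hg q u
    have hfl := Nat.floor_le (mul_nonneg hmq.le hu0)
    have hfl2 := Nat.lt_floor_add_one ((m : ℝ) ^ q * u)
    set i := ⌊(m : ℝ) ^ q * u⌋₊ with hi
    have hu' : x - δ ≤ g u ∧ g u ≤ x + δ := hu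
    have hgu' : a + (φ q i : ℝ) * δ ≤ g u ∧ g u ≤ a + ((φ q i : ℝ) + 1) * δ := hgu
    have e : (x - a) = (x - a) / δ * δ := by field_simp
    have h1 : (x - a) / δ - 2 ≤ φ q i := by
      have : ((x - a) / δ - 2) * δ ≤ φ q i * δ := by linarith
      exact le_of_mul_le_mul_right this hδp
    have h2 : (φ q i : ℝ) ≤ (x - a) / δ - 2 + 3 := by
      have : (φ q i : ℝ) * δ ≤ ((x - a) / δ - 2 + 3) * δ := by linarith
      exact le_of_mul_le_mul_right this hδp
    have h3 : n0 ≤ φ q i := Nat.ceil_le.2 h1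
    have h4 : φ q i ≤ n0 + 3 := by
      have : (φ q i : ℝ) ≤ n0 + 3 := h2.trans (by linarith [Nat.le_ceil ((x - a) / δ - 2)])
      exact_mod_cast this
    have h5 : i < m ^ q := by
      have : (i : ℝ) < (m : ℝ) ^ q := by nlinarith
      exact_mod_cast this
    simp only [Set.mem_iUnion]
    refine ⟨i, Finset.mem_filter.2 ⟨Finset.mem_range.2 h5, Finset.mem_Ico.2 ⟨h3, by omega⟩⟩, ?_, ?_⟩
    · rw [div_le_iff₀ hmq]; linarith
    · rw [lt_div_iff₀ hmq]; linarith
  refine (measure_mono hsub).trans ((measure_biUnion_finset_le _ _).trans ?_)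
  have : ∀ i ∈ I, volume (Set.Ico ((i : ℝ) / (m : ℝ) ^ q) ((i + 1) / (m : ℝ) ^ q)) ≤
      ENNReal.ofReal (1 / (m : ℝ) ^ q) := by
    intro i _
    rw [Real.volume_Ico]
    apply le_of_eq
    congr 1
    ring
  refine (Finset.sum_le_card_nsmul _ _ _ this).trans ?_
  rw [nsmul_eq_mul]
  calc (I.card : ENNReal) * ENNReal.ofReal (1 / (m : ℝ) ^ q)
      ≤ (4 : ENNReal) * ENNReal.ofReal (1 / (m : ℝ) ^ q) := by
        gcongr; exact_mod_cast hcard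
    _ = ENNReal.ofReal (4 / (m : ℝ) ^ q) := by
        rw [show (4 : ENNReal) = ENNReal.ofReal 4 by norm_num, ← ENNReal.ofReal_mul (by norm_num)]
        congr 1; ring

theorem dim_lower {a L : ℝ} (hL : 0 < L) {R m : ℕ} (hR : 2 ≤ R) (hm : 2 ≤ m) (σ : NNReal)
    (hσ : (R : ℝ) ^ (σ : ℝ) = m) (G : ℕ → Set ℕ) (h0 : 0 ∈ G 0)
    (hG : ∀ q, ∀ j ∈ G q, ∃ S : Finset ℕ, (∀ k ∈ S, k < R ∧ R * j + k ∈ G (q + 1)) ∧ m ≤ S.card)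
    (K : Set ℝ) (hK : ∀ x, (∀ q, ∃ j ∈ G q, x ∈ iv a L R q j) → x ∈ K) : (σ : ENNReal) ≤ dimH K := by
  have hRp : 0 < R := by omega
  have hmp : 0 < m := by omega
  have hR' : (0 : ℝ) < R := by exact_mod_cast hRp
  have hm' : (0 : ℝ) < m := by exact_mod_cast hmp
  obtain ⟨φ, hφ1, hφ2, hφ3⟩ := exists_phi hRp hmp G h0 hG
  obtain ⟨g, hgm, hg⟩ := exists_g (a := a) hL hRp hmp φ hφ2
  have hvol := vol_est hL hRp hmp φ hφ3 g hg
  set μ : Measure ℝ := (volume.restrict (Set.Ico (0 : ℝ) 1)).map g with hμ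
  have hμI : ∀ q x, μ (Set.Icc (x - L / (R : ℝ) ^ q) (x + L / (R : ℝ) ^ q)) ≤
      ENNReal.ofReal (4 / (m : ℝ) ^ q) := by
    intro q x
    rw [hμ, Measure.map_apply hgm measurableSet_Icc,
      Measure.restrict_apply (hgm measurableSet_Icc)]
    exact hvol q x
  set κ : ℝ := L ^ (σ : ℝ) / (4 * m) with hκ
  have hκp : 0 < κ := by positivity
  have hle : ENNReal.ofReal κ • μ ≤ μH[(σ : ℝ)] := by
    refine Measure.le_hausdorffMeasure _ _ (ENNReal.ofReal L) (by simpa using hL) ?_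
    intro s hs
    rw [Measure.smul_apply, smul_eq_mul]
    rcases s.eq_empty_or_nonempty with rfl | ⟨x, hx⟩
    · simp
    have hfin : Metric.ediam s ≠ ⊤ := (hs.trans_lt ENNReal.ofReal_lt_top).ne
    set d := (Metric.ediam s).toReal with hd
    have hd0 : 0 ≤ d := ENNReal.toReal_nonneg
    have hed : Metric.ediam s = ENNReal.ofReal d := (ENNReal.ofReal_toReal hfin).symm
    have hdL : d ≤ L := ENNReal.toReal_le_of_le_ofReal hL.le hs
    have hsub : ∀ r, d ≤ r → s ⊆ Set.Icc (x - r) (x + r) := by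
      intro r hr y hy
      have h1 : edist y x ≤ ENNReal.ofReal d := hed ▸ Metric.edist_le_ediam_of_mem hy hx
      rw [edist_dist, ENNReal.ofReal_le_ofReal_iff hd0, Real.dist_eq, abs_le] at h1
      exact ⟨by linarith, by linarith⟩
    have hμs : ∀ q, d ≤ L / (R : ℝ) ^ q → μ s ≤ ENNReal.ofReal (4 / (m : ℝ) ^ q) := fun q hq =>
      (measure_mono (hsub _ hq)).trans (hμI q x)
    rcases hd0.eq_or_lt with h | hdp
    · have h1 : μ s ≤ ENNReal.ofReal 0 := by
        refine ge_of_tendsto' (f := fun q : ℕ => ENNReal.ofReal (4 / (m : ℝ) ^ q))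
          (x := Filter.atTop) (ENNReal.tendsto_ofReal ?_) (fun q => hμs q (by rw [← h]; positivity))
        refine Filter.Tendsto.div_atTop tendsto_const_nhds (tendsto_pow_atTop_atTop_of_one_lt ?_)
        exact_mod_cast (by omega : 1 < m)
      have h2 : μ s = 0 := by simpa using h1
      simp [h2]
    · obtain ⟨q, hq1, hq2⟩ := exists_nat_pow_near_of_lt_one (x := d / L) (y := 1 / (R : ℝ))
        (by positivity) (by rw [div_le_one hL]; exact hdL) (by positivity)
        (by rw [div_lt_one hR']; exact_mod_cast (by omega : 1 < R))
      have h1 : d ≤ L / (R : ℝ) ^ q := by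
        rw [div_le_iff₀ hL] at hq2
        calc d ≤ _ := hq2
          _ = _ := by rw [one_div, inv_pow]; ring
      have h2 : 1 / (m : ℝ) ^ (q + 1) ≤ (d / L) ^ (σ : ℝ) := by
        calc 1 / (m : ℝ) ^ (q + 1) = ((1 / (R : ℝ)) ^ (q + 1)) ^ (σ : ℝ) := by
              rw [← hσ, ← Real.rpow_natCast, ← Real.rpow_natCast, ← Real.rpow_mul hR'.le,
                ← Real.rpow_mul (by positivity), one_div, one_div, Real.inv_rpow hR'.le,
                mul_comm]
          _ ≤ _ := Real.rpow_le_rpow (by positivity) hq1.le σ.2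
      calc ENNReal.ofReal κ * μ s ≤ ENNReal.ofReal κ * ENNReal.ofReal (4 / (m : ℝ) ^ q) := by
            gcongr; exact hμs q h1
        _ = ENNReal.ofReal (κ * (4 / (m : ℝ) ^ q)) := (ENNReal.ofReal_mul hκp.le).symm
        _ ≤ ENNReal.ofReal (d ^ (σ : ℝ)) := by
            apply ENNReal.ofReal_le_ofReal
            rw [Real.div_rpow hd0 hL.le, le_div_iff₀ (by positivity)] at h2
            refine le_trans (le_of_eq ?_) h2
            rw [hκ, pow_succ]; field_simp
        _ = Metric.ediam s ^ (σ : ℝ) := by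
            rw [hed, ENNReal.ofReal_rpow_of_pos hdp]
  apply le_dimH_of_hausdorffMeasure_ne_zero
  have h1 : (1 : ENNReal) ≤ μ K := by
    have h2 := Measure.le_map_apply (μ := volume.restrict (Set.Ico (0 : ℝ) 1))
      hgm.aemeasurable K
    have h3 : g ⁻¹' K = Set.univ := by
      ext u
      simp only [Set.mem_preimage, Set.mem_univ, iff_true]
      exact hK _ (fun q => ⟨_, hφ1 q _, hg q u⟩)
    rw [h3] at h2
    simpa using h2
  have h2 := hle K
  rw [Measure.smul_apply, smul_eq_mul] at h2
  have h3 : 0 < ENNReal.ofReal κ * μ K :=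
    ENNReal.mul_pos (by simpa using hκp) (one_pos.trans_le h1).ne'
  exact (h3.trans_le h2).ne'

theorem stmt17 (X : Set ℝ)
    (h : ∃ a b : ℝ, a < b ∧ CantorRichIn X (Set.Icc a b)) :
    dimH X = 1 := by
    classical
  obtain ⟨a, b, hab, M, hM, hrich⟩ := h
  apply le_antisymm
  · exact (dimH_mono (Set.subset_univ X)).trans Real.dimH_univ.le
  have key : ∀ n : ℕ, 1 ≤ n → M ≤ n → ENNReal.ofReal ((n : ℝ) / ((n : ℝ) + 1)) ≤ dimH X := by
    intro n hn hMn
    have hR : (2 : ℕ) ^ (n + 1) = 2 * 2 ^ n := pow_succ' 2 n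
    have hm2 : 2 ≤ 2 ^ n := by
      calc 2 = 2 ^ 1 := by norm_num
        _ ≤ 2 ^ n := Nat.pow_le_pow_right (by norm_num) hn
    have hMR : M ≤ ((2 ^ (n + 1) : ℕ) : ℝ) := by
      refine hMn.trans ?_
      have : n < 2 ^ n := Nat.lt_two_pow_self
      exact_mod_cast (by omega : n ≤ 2 ^ (n + 1))
    obtain ⟨C, hC, hCX, hd⟩ := hrich (1 / 2) (by norm_num) (2 ^ (n + 1)) hMR
    have hRp : 0 < 2 ^ (n + 1) := by positivity
    obtain ⟨G, hG0, hGA, hGm⟩ := exists_regular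
      (fun q => {j | iv a (b - a) (2 ^ (n + 1)) q j ∈ C q}) (2 ^ (n + 1)) (2 ^ n) hR (by omega)
      (by
        simp only [Set.mem_ofPred_eq, hC.1]
        simp [iv])
      (fun q x hx => (split_iff hab hRp hC q x).1 (hC.2 q hx))
      (combHyp_of hab hRp hC hd)
    have hσ : ((2 ^ (n + 1) : ℕ) : ℝ) ^ ((Real.toNNReal ((n : ℝ) / ((n : ℝ) + 1)) : NNReal) : ℝ)
        = ((2 ^ n : ℕ) : ℝ) := by
      rw [Real.coe_toNNReal _ (by positivity)]
      push_cast
      rw [← Real.rpow_natCast, ← Real.rpow_natCast, ← Real.rpow_mul (by norm_num)]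
      congr 1
      push_cast
      field_simp
    refine (dim_lower (a := a) (sub_pos.2 hab) (by omega) hm2 _ hσ G hG0 (fun q j hj =>
      ⟨_, fun k hk => ?_, hGm q j hj⟩) (limitK C) ?_).trans (dimH_mono hCX)
    · have := Finset.mem_filter.1 hk
      exact ⟨Finset.mem_range.1 this.1, this.2⟩
    · intro x hx
      refine Set.mem_iInter.2 (fun q => ?_)
      obtain ⟨j, hj, hxj⟩ := hx q
      exact Set.mem_biUnion (hGA q hj) hxj
  have hlim : Filter.Tendsto (fun n : ℕ => ENNReal.ofReal ((n : ℝ) / ((n : ℝ) + 1)))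
      Filter.atTop (nhds (ENNReal.ofReal 1)) :=
    ENNReal.tendsto_ofReal (tendsto_natCast_div_add_atTop (1 : ℝ))
  rw [ENNReal.ofReal_one] at hlim
  refine le_of_tendsto hlim ?_
  filter_upwards [Filter.eventually_ge_atTop (max 1 ⌈M⌉₊)] with n hn
  exact key n (le_of_max_le_left hn) ((Nat.le_ceil M).trans (by exact_mod_cast le_of_max_le_right hn))
end

section
/- Let I₀ be a compact interval in ℝ and M > 1. Then any countable intersection of sets each of which is M-Cantor rich in I₀ is itself M-Cantor rich in I₀. In particular, any finite intersection of Cantor rich sets in I₀ is Cantor rich in I₀. -/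
def gridI (a L : ℝ) (R q m : ℕ) : Set ℝ :=
  Set.Icc (a + m * (L / R ^ q)) (a + (m + 1) * (L / R ^ q))

lemma Icc_inj_of_le {a b c d : ℝ} (h : a ≤ b) (e : Set.Icc a b = Set.Icc c d) :
    a = c ∧ b = d := by
  have h1 : a ∈ Set.Icc c d := e ▸ ⟨le_rfl, h⟩
  have h2 : b ∈ Set.Icc c d := e ▸ ⟨h, le_rfl⟩
  have hcd : c ≤ d := h1.1.trans h1.2
  have h3 : c ∈ Set.Icc a b := e.symm ▸ (⟨le_rfl, hcd⟩ : c ∈ Set.Icc c d)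
  have h4 : d ∈ Set.Icc a b := e.symm ▸ (⟨hcd, le_rfl⟩ : d ∈ Set.Icc c d)
  exact ⟨le_antisymm h3.1 h1.1, le_antisymm h2.2 h4.2⟩

lemma gridI_inj {a L : ℝ} (hL : 0 < L) {R : ℕ} (hR : 0 < R) (q m n : ℕ)
    (e : gridI a L R q m = gridI a L R q n) : m = n := by
  have hR' : (0 : ℝ) < R := by exact_mod_cast hR
  have hh : 0 < L / (R : ℝ) ^ q := by positivity
  have := (Icc_inj_of_le (by nlinarith) e).1
  have h2 : (m : ℝ) * (L / (R : ℝ) ^ q) = n * (L / (R : ℝ) ^ q) := by linarith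
  exact_mod_cast mul_right_cancel₀ hh.ne' h2

lemma splitR_grid {a L : ℝ} {R : ℕ} (hR : 0 < R) (q : ℕ) (C : Set (Set ℝ))
    (hC : ∀ J ∈ C, ∃ m, J = gridI a L R q m) (J : Set ℝ) (hJ : J ∈ splitR R C) :
    ∃ m k : ℕ, k < R ∧ gridI a L R q m ∈ C ∧ J = gridI a L R (q + 1) (m * R + k) := by
  have hR' : (0 : ℝ) < R := by exact_mod_cast hR
  obtain ⟨c, d, hcd, hm, k, hk, rfl⟩ := hJ
  obtain ⟨m, e⟩ := hC _ hm
  refine ⟨m, k, hk, e ▸ hm, ?_⟩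
  obtain ⟨rfl, rfl⟩ := Icc_inj_of_le hcd e
  unfold gridI
  congr 1 <;> (push_cast; field_simp; ring)

lemma rseq_grid {a b : ℝ} {R : ℕ} (hR : 0 < R) {C : ℕ → Set (Set ℝ)}
    (hC : IsRSeq R (Set.Icc a b) C) (q : ℕ) : ∀ J ∈ C q, ∃ m, J = gridI a (b - a) R q m := by
  induction q with
  | zero =>
    intro J hJ
    rw [hC.1] at hJ
    exact ⟨0, by rw [Set.mem_singleton_iff.1 hJ]; simp [gridI]⟩
  | succ q ih =>
    intro J hJ
    obtain ⟨m, k, -, -, e⟩ := splitR_grid hR q _ ih J (hC.2 q hJ)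
    exact ⟨_, e⟩

lemma splitR_mono (R : ℕ) {C D : Set (Set ℝ)} (h : C ⊆ D) : splitR R C ⊆ splitR R D := by
  rintro J ⟨a, b, hab, hm, k⟩
  exact ⟨a, b, hab, h hm, k⟩

lemma inter_rseq {a b : ℝ} (hab : a < b) {R : ℕ} (hR : 0 < R) (C : ℕ → ℕ → Set (Set ℝ))
    (hC : ∀ j, IsRSeq R (Set.Icc a b) (C j)) :
    IsRSeq R (Set.Icc a b) (fun q => ⋂ j, C j q) := by
  have hL : 0 < b - a := by linarith
  have hR' : (0 : ℝ) < R := by exact_mod_cast hR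
  constructor
  · simp [(hC _).1, Set.iInter_const]
  · intro q J hJ
    have hJ' : ∀ j, J ∈ C j (q + 1) := by simpa using hJ
    have key := fun j => splitR_grid hR q _ (rseq_grid hR (hC j) q) J ((hC j).2 q (hJ' j))
    obtain ⟨m, k, hk, -, e⟩ := key 0
    have hmem : ∀ j, gridI a (b - a) R q m ∈ C j q := by
      intro j
      obtain ⟨m', k', hk', hm', e'⟩ := key j
      have := gridI_inj hL hR _ _ _ (e.symm.trans e')
      have h1 : m = m' := by
        have := congrArg (· / R) this
        simpa [Nat.add_div_of_dvd_right, Nat.div_eq_of_lt, hk, hk', hR, mul_comm _ R,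
          Nat.mul_add_div] using this
      exact h1 ▸ hm'
    refine ⟨a + m * ((b - a) / R ^ q), a + (m + 1) * ((b - a) / R ^ q), ?_, ?_, k, hk, ?_⟩
    · have : 0 < (b - a) / (R : ℝ) ^ q := by positivity
      nlinarith
    · exact Set.mem_iInter.2 hmem
    · rw [e]
      unfold gridI
      congr 1 <;> (push_cast; field_simp; ring)

lemma encard_iUnion_le_tsum (S : ℕ → Set (Set ℝ)) :
    ((⋃ j, S j).encard : ENNReal) ≤ ∑' j, ((S j).encard : ENNReal) := by
  letI : MeasurableSpace (Set ℝ) := ⊤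
  have := MeasureTheory.measure_iUnion_le (μ := MeasureTheory.Measure.count) S
  simpa [MeasureTheory.Measure.count_apply] using this

lemma dq_inter (R : ℕ) (C : ℕ → ℕ → Set (Set ℝ)) (δ : ℕ → ENNReal) (q : ℕ)
    (hd : ∀ j, dq R (C j) q < δ j) :
    dq R (fun q => ⋂ j, C j q) q ≤ ∑' j, δ j := by
  have h1 : ∀ j, ∃ P : ℕ → Set (Set ℝ), hatC R (C j) q = (⋃ p ∈ Finset.range q, P p) ∧
      ∑ p ∈ Finset.range q, (4 / (R : ENNReal)) ^ (q - p) *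
      ⨆ Ip ∈ C j p, (({J ∈ P p | J ⊆ Ip} : Set (Set ℝ)).encard : ENNReal) < δ j := by
    intro j
    have := hd j
    simp only [dq, iInf_lt_iff] at this
    obtain ⟨P, h, h'⟩ := this
    exact ⟨P, h, h'⟩
  choose P hP hlt using h1
  set D : ℕ → Set (Set ℝ) := fun q => ⋂ j, C j q with hD
  have hsub : hatC R D q ⊆ ⋃ j, hatC R (C j) q := by
    rintro J ⟨hJ, hJ'⟩
    obtain ⟨j, hj⟩ : ∃ j, J ∉ C j q := by simpa [hD] using hJ'
    exact Set.mem_iUnion.2 ⟨j, splitR_mono R (Set.iInter_subset _ j) hJ, hj⟩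
  refine (iInf₂_le (fun p => (⋃ j, P j p) ∩ hatC R D q) ?_).trans ?_
  · ext J
    constructor
    · intro hJ
      obtain ⟨j, hj⟩ := Set.mem_iUnion.1 (hsub hJ)
      rw [hP j] at hj
      simp only [Set.mem_iUnion] at hj ⊢
      obtain ⟨p, hp, h⟩ := hj
      exact ⟨p, hp, Set.mem_iUnion.2 ⟨j, h⟩, hJ⟩
    · simp only [Set.mem_iUnion]
      rintro ⟨p, hp, -, h⟩
      exact h
  · calc _ ≤ ∑ p ∈ Finset.range q, (4 / (R : ENNReal)) ^ (q - p) *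
        ∑' j, ⨆ Ip ∈ C j p, (({J ∈ P j p | J ⊆ Ip} : Set (Set ℝ)).encard : ENNReal) := by
          refine Finset.sum_le_sum fun p _ => mul_le_mul_right ?_ _
          refine iSup₂_le fun I hI => ?_
          calc _ ≤ ((⋃ j, {J ∈ P j p | J ⊆ I}).encard : ENNReal) := by
                apply ENat.toENNReal_le.2
                apply Set.encard_le_encard
                rintro J ⟨⟨h, -⟩, h'⟩
                obtain ⟨j, hj⟩ := Set.mem_iUnion.1 h
                exact Set.mem_iUnion.2 ⟨j, hj, h'⟩
            _ ≤ _ := encard_iUnion_le_tsum _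
            _ ≤ _ := ENNReal.tsum_le_tsum fun j =>
                le_iSup₂ (f := fun Ip (_ : Ip ∈ C j p) =>
                  (({J ∈ P j p | J ⊆ Ip} : Set (Set ℝ)).encard : ENNReal)) I
                  (Set.mem_iInter.1 hI j)
      _ = ∑' j, ∑ p ∈ Finset.range q, (4 / (R : ENNReal)) ^ (q - p) *
          ⨆ Ip ∈ C j p, (({J ∈ P j p | J ⊆ Ip} : Set (Set ℝ)).encard : ENNReal) := by
          rw [Summable.tsum_finsetSum fun _ _ => ENNReal.summable]
          simp only [ENNReal.tsum_mul_left]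
      _ ≤ _ := ENNReal.tsum_le_tsum fun j => (hlt j).le

lemma inter_rich {a b : ℝ} (hab : a < b) (M : ℝ) (hM : 1 < M) (X : ℕ → Set ℝ)
    (hX : ∀ j, MCantorRichIn M (X j) (Set.Icc a b)) :
    MCantorRichIn M (⋂ j, X j) (Set.Icc a b) := by
  intro ε hε R hR
  have hR0 : 0 < R := by
    have : (0 : ℝ) < R := by linarith
    exact_mod_cast this
  obtain ⟨δ, hδ, hs⟩ := ENNReal.exists_pos_sum_of_countable (ε := ENNReal.ofReal ε)
    (by simpa using hε) ℕ
  have h1 : ∀ j, ∃ C, IsRSeq R (Set.Icc a b) C ∧ limitK C ⊆ X j ∧ dC R C < δ j := by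
    intro j
    have hp : (0 : ℝ) < δ j := hδ j
    obtain ⟨C, h, h', h''⟩ := hX j (δ j / 2) (by positivity) R hR
    refine ⟨C, h, h', h''.trans_lt ?_⟩
    rw [← ENNReal.ofReal_coe_nnreal]
    exact (ENNReal.ofReal_lt_ofReal_iff hp).2 (by linarith)
  choose C hC hK hd using h1
  refine ⟨_, inter_rseq hab hR0 C hC, ?_, ?_⟩
  · refine Set.subset_iInter fun j => Set.Subset.trans ?_ (hK j)
    exact Set.iInter_mono fun q =>
      Set.biUnion_subset_biUnion_left (Set.iInter_subset _ j)
  · refine iSup₂_le fun q hq => (dq_inter R C _ q fun j => ?_).trans hs.le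
    exact (le_iSup₂ (f := fun q (_ : 0 < q) => dq R (C j) q) q hq).trans_lt (hd j)

lemma univ_rich (M : ℝ) (I₀ : Set ℝ) : MCantorRichIn M Set.univ I₀ := by
  intro ε hε R hR
  refine ⟨fun q => (splitR R)^[q] {I₀}, ⟨rfl, fun q => ?_⟩, Set.subset_univ _, ?_⟩
  · simp only [Function.iterate_succ_apply']
    exact subset_rfl
  · refine iSup₂_le fun q hq => ?_
    refine (iInf₂_le (fun _ => ∅) ?_).trans ?_
    · obtain ⟨q, rfl⟩ := Nat.exists_eq_succ_of_ne_zero hq.ne'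
      simp [hatC, Function.iterate_succ_apply']
    · simp

theorem stmt18 (a b : ℝ) (hab : a < b) (I₀ : Set ℝ) (hI₀ : I₀ = Set.Icc a b) :
    (∀ M : ℝ, 1 < M → ∀ X : ℕ → Set ℝ,
      (∀ j, MCantorRichIn M (X j) I₀) → MCantorRichIn M (⋂ j, X j) I₀) ∧
    (∀ (N : ℕ) (X : Fin N → Set ℝ),
      (∀ j, CantorRichIn (X j) I₀) → CantorRichIn (⋂ j, X j) I₀) := by
  subst hI₀
  refine ⟨fun M hM X hX => inter_rich hab M hM X hX, fun N X hX => ?_⟩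
  choose M hM hr using hX
  have hle : ∀ j, M j ≤ 2 + ∑ i, M i := fun j => by
    have := Finset.single_le_sum (f := M) (fun i _ => by linarith [hM i]) (Finset.mem_univ j)
    linarith
  have h0 : 0 ≤ ∑ i, M i := Finset.sum_nonneg fun i _ => by linarith [hM i]
  refine ⟨2 + ∑ i, M i, by linarith, ?_⟩
  have := inter_rich hab (2 + ∑ i, M i) (by linarith)
    (fun n => if h : n < N then X ⟨n, h⟩ else Set.univ) (fun n => by
      by_cases h : n < N
      · simp only [h, dif_pos]
        exact fun ε hε R hR => hr ⟨n, h⟩ ε hε R ((hle _).trans hR)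
      · simp only [h, dif_neg, not_false_eq_true]
        exact univ_rich _ _)
  convert this using 1
  ext x
  simp only [Set.mem_iInter]
  constructor
  · intro hx n
    by_cases h : n < N
    · simpa [h] using hx ⟨n, h⟩
    · simp [h]
  · intro hx j
    simpa using hx j.1
end
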